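/- Let n(x) denote the number of positive integers n ≤ x such that the n×n square has no perfect Mondrian partition (equivalently, d(n) ≠ 0). Then n(x)/x is asymptotically at least (log log x)²/(2 log x) as x → ∞; more precisely, n(x) is bounded below by a function asymptotic to Σ_{s=1}^{3} (x/log x)·(log log x)^{s−1}/(s−1)!, whose leading term is x·(log log x)²/(2 log x). -/

import Mathlib

/-- An axis-aligned rectangle with integer coordinates placed on the grid:
lower-left corner `(x, y)`, width `w`, and height `h`. -/
structure Rect where
  x : ℕ
  y : ℕ
  w : ℕ
  h : ℕ
deriving DecidableEq

/-- The area of a rectangle. -/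
def Rect.area (r : Rect) : ℕ := r.w * r.h

/-- Two rectangles are congruent if they have the same dimensions,
possibly after a ninety-degree rotation. -/
def Rect.Congruent (r s : Rect) : Prop :=
  (r.w = s.w ∧ r.h = s.h) ∨ (r.w = s.h ∧ r.h = s.w)

/-- The rectangle `r` covers the unit grid cell `[i, i+1) × [j, j+1)`. -/
def Rect.Covers (r : Rect) (i j : ℕ) : Prop :=
  r.x ≤ i ∧ i < r.x + r.w ∧ r.y ≤ j ∧ j < r.y + r.h

/-- A Mondrian partition of the `n × n` square: a finite collection of
pairwise non-congruent rectangles with positive integer side lengths that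
tile the square (every cell of the square is covered by exactly one
rectangle, and rectangles lie inside the square). -/
structure Mondrian (n : ℕ) where
  rects : Finset Rect
  pos : ∀ r ∈ rects, 0 < r.w ∧ 0 < r.h
  inside : ∀ r ∈ rects, r.x + r.w ≤ n ∧ r.y + r.h ≤ n
  cover : ∀ i j : ℕ, i < n → j < n → ∃! r : Rect, r ∈ rects ∧ r.Covers i j
  noncong : ∀ r ∈ rects, ∀ s ∈ rects, r ≠ s → ¬ r.Congruent s

/-- The defect of a Mondrian partition: the difference between the largest
and the smallest rectangle areas. -/
def Mondrian.defect {n : ℕ} (P : Mondrian n) : ℕ :=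
  P.rects.sup fun r => P.rects.sup fun s => r.area - s.area

/-- A Mondrian partition is perfect if all its rectangles have the same area. -/
def Mondrian.IsPerfect {n : ℕ} (P : Mondrian n) : Prop :=
  ∀ r ∈ P.rects, ∀ s ∈ P.rects, r.area = s.area

/-- `mondrianDk n k` is the minimum defect over all Mondrian partitions of the
`n × n` square using exactly `k` rectangles. -/
noncomputable def mondrianDk (n k : ℕ) : ℕ :=
  sInf {d | ∃ P : Mondrian n, P.rects.card = k ∧ P.defect = d}

/-- `mondrianD n` is the minimum defect over all Mondrian partitions of the
`n × n` square (into at least two rectangles). -/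
noncomputable def mondrianD (n : ℕ) : ℕ :=
  sInf {d | ∃ P : Mondrian n, 2 ≤ P.rects.card ∧ P.defect = d}

/-- `n` admits no perfect Mondrian partition. -/
def NoPerfect (n : ℕ) : Prop :=
  ¬ ∃ P : Mondrian n, 2 ≤ P.rects.card ∧ P.IsPerfect

/-- `nCount x` is the number of side lengths `n ≤ x` whose square has no
perfect Mondrian partition. -/
noncomputable def nCount (x : ℕ) : ℕ :=
  Set.ncard {n : ℕ | 1 ≤ n ∧ n ≤ x ∧ NoPerfect n}

/-- The unit cells, indexed by their lower-left corners, contained in a rectangle. -/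
def Rect.cells (r : Rect) : Finset (ℕ × ℕ) :=
  Finset.Ico r.x (r.x + r.w) ×ˢ Finset.Ico r.y (r.y + r.h)

theorem Rect.mem_cells {r : Rect} {c : ℕ × ℕ} : c ∈ r.cells ↔ r.Covers c.1 c.2 := by
  simp [Rect.cells, Rect.Covers, and_assoc]

theorem Rect.card_cells (r : Rect) : r.cells.card = r.area := by
  simp [Rect.cells, Rect.area]

namespace Mondrian

variable {n : ℕ} (P : Mondrian n)

theorem lt_of_covers {r : Rect} (hr : r ∈ P.rects) {i j : ℕ} (h : r.Covers i j) :
    i < n ∧ j < n := by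
  have := P.inside r hr
  unfold Rect.Covers at h
  omega

theorem eq_of_covers {r s : Rect} (hr : r ∈ P.rects) (hs : s ∈ P.rects) {i j : ℕ}
    (hri : r.Covers i j) (hsi : s.Covers i j) : r = s := by
  obtain ⟨hi, hj⟩ := P.lt_of_covers hr hri
  exact (P.cover i j hi hj).unique ⟨hr, hri⟩ ⟨hs, hsi⟩

theorem sum_area : ∑ r ∈ P.rects, r.area = n ^ 2 := by
  have hU : P.rects.biUnion Rect.cells = Finset.range n ×ˢ Finset.range n := by
    ext ⟨i, j⟩
    simp only [Finset.mem_biUnion, Rect.mem_cells, Finset.mem_product, Finset.mem_range]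
    constructor
    · rintro ⟨r, hr, h⟩
      exact P.lt_of_covers hr h
    · rintro ⟨hi, hj⟩
      exact (P.cover i j hi hj).exists
  have hD : ∀ r ∈ P.rects, ∀ s ∈ P.rects, r ≠ s → Disjoint r.cells s.cells := by
    intro r hr s hs hrs
    rw [Finset.disjoint_left]
    intro c hc hc'
    exact hrs (P.eq_of_covers hr hs (Rect.mem_cells.1 hc) (Rect.mem_cells.1 hc'))
  have := congrArg Finset.card hU
  rw [Finset.card_biUnion hD, Finset.card_product, Finset.card_range] at this
  simpa [Rect.card_cells, sq] using this

theorem card_le_card_divisors {A : ℕ} (hA : A ≠ 0) (h : ∀ r ∈ P.rects, r.area = A) :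
    P.rects.card ≤ A.divisors.card := by
  refine Finset.card_le_card_of_injOn Rect.w ?_ ?_
  · intro r hr
    exact Nat.mem_divisors.2 ⟨⟨r.h, (h r hr).symm⟩, hA⟩
  · intro r hr s hs hw
    by_contra hne
    refine P.noncong r hr s hs hne (Or.inl ⟨hw, ?_⟩)
    have hrs : r.w * r.h = s.w * s.h := (h r hr).trans (h s hs).symm
    change r.w = s.w at hw
    rw [← hw] at hrs
    exact Nat.eq_of_mul_eq_mul_left (P.pos r hr).1 hrs

theorem dvd_x {p : ℕ} (h : ∀ r ∈ P.rects, p ∣ r.w) : ∀ r ∈ P.rects, p ∣ r.x := by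
  suffices ∀ a, ∀ r ∈ P.rects, r.x = a → p ∣ a from fun r hr => this _ r hr rfl
  intro a
  induction a using Nat.strong_induction_on with
  | _ a ih =>
    intro r hr ha
    rcases Nat.eq_zero_or_pos a with rfl | ha0
    · exact dvd_zero p
    have hpos := P.pos r hr
    have hin := P.inside r hr
    obtain ⟨s, ⟨hs, hsc⟩, -⟩ := P.cover (a - 1) r.y (by omega) (by omega)
    have hne : ¬ s.Covers a r.y := fun hc => by
      have hrs := P.eq_of_covers hr hs (i := a) (j := r.y)
        ⟨by omega, by omega, le_rfl, by omega⟩ hc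
      subst hrs
      unfold Rect.Covers at hsc
      omega
    unfold Rect.Covers at hsc hne
    have hx : s.x + s.w = a := by omega
    rw [← hx]
    exact dvd_add (ih s.x (by omega) s hs rfl) (h s hs)

theorem dvd_y {p : ℕ} (h : ∀ r ∈ P.rects, p ∣ r.h) : ∀ r ∈ P.rects, p ∣ r.y := by
  suffices ∀ a, ∀ r ∈ P.rects, r.y = a → p ∣ a from fun r hr => this _ r hr rfl
  intro a
  induction a using Nat.strong_induction_on with
  | _ a ih =>
    intro r hr ha
    rcases Nat.eq_zero_or_pos a with rfl | ha0
    · exact dvd_zero p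
    have hpos := P.pos r hr
    have hin := P.inside r hr
    obtain ⟨s, ⟨hs, hsc⟩, -⟩ := P.cover r.x (a - 1) (by omega) (by omega)
    have hne : ¬ s.Covers r.x a := fun hc => by
      have hrs := P.eq_of_covers hr hs (i := r.x) (j := a)
        ⟨le_rfl, by omega, by omega, by omega⟩ hc
      subst hrs
      unfold Rect.Covers at hsc
      omega
    unfold Rect.Covers at hsc hne
    have hx : s.y + s.h = a := by omega
    rw [← hx]
    exact dvd_add (ih s.y (by omega) s hs rfl) (h s hs)

end Mondrian

/-- The rectangle obtained by scaling all coordinates and sides by `p`. -/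
def Rect.scale (p : ℕ) (r : Rect) : Rect := ⟨p * r.x, p * r.y, p * r.w, p * r.h⟩

theorem Rect.scale_injective {p : ℕ} (hp : 0 < p) : Function.Injective (Rect.scale p) := by
  rintro ⟨x, y, w, h⟩ ⟨x', y', w', h'⟩ hrs
  simpa [Rect.scale, hp.ne'] using hrs

theorem Rect.covers_scale {p : ℕ} (hp : 0 < p) (r : Rect) (i j : ℕ) :
    (r.scale p).Covers (p * i) (p * j) ↔ r.Covers i j := by
  simp only [Rect.Covers, Rect.scale, ← mul_add, mul_le_mul_iff_right₀ hp,
    mul_lt_mul_iff_right₀ hp]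

namespace Mondrian

/-- A tiling of the `(p * m) × (p * m)` square by rectangles scaled by `p` comes from a tiling of
the `m × m` square. -/
theorem exists_scale {m p : ℕ} (hp : 0 < p) (P : Mondrian (p * m))
    (h : ∀ r ∈ P.rects, p ∣ r.w ∧ p ∣ r.h) :
    ∃ Q : Mondrian m, P.rects = Q.rects.image (Rect.scale p) := by
  classical
  have hx := P.dvd_x fun r hr => (h r hr).1
  have hy := P.dvd_y fun r hr => (h r hr).2
  obtain ⟨S, hS⟩ : ∃ S : Finset Rect, S.image (Rect.scale p) = P.rects := by
    refine ⟨P.rects.preimage _ (Rect.scale_injective hp).injOn, ?_⟩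
    rw [Finset.image_preimage, Finset.filter_true_of_mem]
    rintro ⟨x, y, w, k⟩ hr
    obtain ⟨a, ha⟩ := hx _ hr
    obtain ⟨b, hb⟩ := hy _ hr
    obtain ⟨⟨c, hc⟩, ⟨d, hd⟩⟩ := h _ hr
    simp only at ha hb hc hd
    exact ⟨⟨a, b, c, d⟩, by simp [Rect.scale, ha, hb, hc, hd]⟩
  have hmem : ∀ r, r ∈ S ↔ r.scale p ∈ P.rects := fun r => by
    rw [← hS, (Rect.scale_injective hp).mem_finset_image]
  refine ⟨⟨S, ?_, ?_, ?_, ?_⟩, hS.symm⟩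
  · intro r hr
    have := P.pos _ ((hmem r).1 hr)
    simpa [Rect.scale, hp] using this
  · intro r hr
    have := P.inside _ ((hmem r).1 hr)
    simpa only [Rect.scale, ← mul_add, mul_le_mul_iff_right₀ hp] using this
  · intro i j hi hj
    obtain ⟨r, ⟨hr, hc⟩, -⟩ := P.cover (p * i) (p * j) (by gcongr) (by gcongr)
    rw [← hS, Finset.mem_image] at hr
    obtain ⟨s, hs, rfl⟩ := hr
    rw [Rect.covers_scale hp] at hc
    refine ⟨s, ⟨hs, hc⟩, fun t ht => Rect.scale_injective hp ?_⟩
    exact P.eq_of_covers ((hmem t).1 ht.1) ((hmem s).1 hs)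
      ((Rect.covers_scale hp t i j).2 ht.2) ((Rect.covers_scale hp s i j).2 hc)
  · intro r hr s hs hrs hc
    refine P.noncong _ ((hmem r).1 hr) _ ((hmem s).1 hs)
      ((Rect.scale_injective hp).ne hrs) ?_
    simpa [Rect.Congruent, Rect.scale, hp.ne'] using hc

end Mondrian

theorem noPerfect_one : NoPerfect 1 := by
  rintro ⟨P, hcard, -⟩
  obtain ⟨r, hr, s, hs, hrs⟩ := Finset.one_lt_card.1 hcard
  have := P.pos r hr
  have := P.pos s hs
  have := P.inside r hr
  have := P.inside s hs
  exact P.noncong r hr s hs hrs (Or.inl ⟨by omega, by omega⟩)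

theorem card_divisors_prime_mul_sq_le {p m : ℕ} (hp : p.Prime) (hpm : p.Coprime m) :
    (p * m ^ 2).divisors.card ≤ 2 * m ^ 2 := by
  rw [(hpm.pow_right 2).card_divisors_mul, hp.divisors, Finset.card_pair hp.one_lt.ne]
  exact Nat.mul_le_mul_left 2 (Nat.card_divisors_le_self _)

/-- Multiplying a side length without perfect Mondrian partition by a prime that is large compared
to it gives another such side length. -/
theorem NoPerfect.prime_mul {m p : ℕ} (hm : 0 < m) (hp : p.Prime) (hmp : 2 * m ^ 2 < p)
    (h : NoPerfect m) : NoPerfect (p * m) := by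
  rintro ⟨P, hcard, hP⟩
  have hmp' : m < p := by nlinarith
  have hcop : p.Coprime m := Nat.coprime_of_lt_prime hm.ne' hmp' hp
  obtain ⟨r₀, hr₀⟩ : P.rects.Nonempty := Finset.card_pos.1 (by omega)
  obtain ⟨A, hA⟩ : ∃ A, ∀ r ∈ P.rects, r.area = A := ⟨r₀.area, fun r hr => hP r hr r₀ hr₀⟩
  have hA0 : A ≠ 0 := by
    rw [← hA r₀ hr₀]
    exact (Nat.mul_pos (P.pos r₀ hr₀).1 (P.pos r₀ hr₀).2).ne'
  have hsum : P.rects.card * A = p ^ 2 * m ^ 2 := by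
    rw [← mul_pow, ← P.sum_area, Finset.sum_congr rfl hA, Finset.sum_const, smul_eq_mul]
  have hk := P.card_le_card_divisors hA0 hA
  have hpA : p ^ 2 ∣ A := by
    by_contra hpA
    have hpk : p ∣ P.rects.card := by
      by_contra hpk
      refine hpA (Nat.Coprime.dvd_of_dvd_mul_left ?_ ⟨m ^ 2, hsum⟩)
      exact ((hp.coprime_iff_not_dvd).2 hpk).pow_left 2
    obtain ⟨k, hk'⟩ := hpk
    have hdvd : A ∣ p * m ^ 2 := by
      refine ⟨k, Nat.eq_of_mul_eq_mul_left hp.pos ?_⟩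
      rw [hk'] at hsum
      linarith
    have h1 : P.rects.card ≤ 2 * m ^ 2 :=
      hk.trans ((Finset.card_le_card (Nat.divisors_subset_of_dvd
        (by positivity [hp.pos]) hdvd)).trans (card_divisors_prime_mul_sq_le hp hcop))
    have h2 : p ≤ P.rects.card := Nat.le_of_dvd (by omega) ⟨k, hk'⟩
    omega
  have hside : ∀ a b : ℕ, a * b = A → 0 < b → b ≤ p * m → p ∣ a := by
    intro a b hab hb hbm
    by_contra hpa
    have : p ^ 2 ∣ b :=
      (((hp.coprime_iff_not_dvd).2 hpa).pow_left 2).dvd_of_dvd_mul_left (hab ▸ hpA)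
    have := Nat.le_of_dvd hb this
    nlinarith [hp.pos]
  obtain ⟨Q, hQ⟩ := P.exists_scale hp.pos (fun r hr => by
    have hin := P.inside r hr
    have hpos := P.pos r hr
    refine ⟨hside r.w r.h (hA r hr) hpos.2 (by omega),
      hside r.h r.w ((mul_comm _ _).trans (hA r hr)) hpos.1 (by omega)⟩)
  refine h ⟨Q, ?_, fun r hr s hs => ?_⟩
  · rwa [hQ, Finset.card_image_of_injective _ (Rect.scale_injective hp.pos)] at hcard
  · have hrs := hP (r.scale p) (hQ ▸ Finset.mem_image_of_mem _ hr)
      (s.scale p) (hQ ▸ Finset.mem_image_of_mem _ hs)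
    have harea : ∀ t : Rect, (t.scale p).area = p ^ 2 * t.area := fun t => by
      simp only [Rect.scale, Rect.area]
      ring
    rw [harea, harea] at hrs
    exact Nat.eq_of_mul_eq_mul_left (pow_pos hp.pos 2) hrs

section

open Filter Asymptotics

/-- The primes in the interval `(a, b]`. -/
def primesIoc (a b : ℕ) : Finset ℕ := (Finset.Ioc a b).filter Nat.Prime

theorem mem_primesIoc {a b p : ℕ} : p ∈ primesIoc a b ↔ (a < p ∧ p ≤ b) ∧ p.Prime := by
  simp [primesIoc]

theorem exists_le_theta_sub_theta : ∃ n₀ : ℕ, ∀ n N : ℕ, n₀ ≤ n → 8 * n ≤ N →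
    (N : ℝ) / 4 ≤ Chebyshev.theta N - Chebyshev.theta n := by
  have h1 : (fun x : ℝ => Real.log (x + 1)) =o[atTop] fun x : ℝ => x := by
    have h := Real.isLittleO_log_id_atTop.comp_tendsto
      (tendsto_atTop_add_const_right atTop (1 : ℝ) tendsto_id)
    refine h.trans_isBigO ?_
    refine IsBigO.of_bound 2 ?_
    filter_upwards [eventually_ge_atTop 1] with x hx
    simp only [Function.comp, id, Real.norm_eq_abs]
    rw [abs_of_nonneg (by linarith), abs_of_nonneg (by linarith)]
    linarith
  have h2 : (fun x : ℝ => 2 * √x * Real.log x) =o[atTop] fun x : ℝ => x := by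
    have h := (isLittleO_log_rpow_atTop (show (0 : ℝ) < 1 / 2 by norm_num)).const_mul_left 2
    have h' := (isBigO_refl (fun x : ℝ => √x) atTop).mul_isLittleO h
    refine (h'.congr' ?_ ?_)
    · exact Eventually.of_forall fun x => by ring
    · filter_upwards [eventually_ge_atTop 0] with x hx
      rw [← Real.sqrt_eq_rpow, Real.mul_self_sqrt hx]
  have h3 := ((h1.add h2).comp_tendsto tendsto_natCast_atTop_atTop).bound
    (show (0 : ℝ) < 1 / 10 by norm_num)
  obtain ⟨n₀, hn₀⟩ := eventually_atTop.1 h3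
  refine ⟨n₀, fun n N hn hN => ?_⟩
  have hb := (le_abs_self _).trans (hn₀ N (by omega))
  simp only [Function.comp, Real.norm_eq_abs, Nat.abs_cast] at hb
  have hlow := Chebyshev.theta_ge N
  have hup := Chebyshev.theta_le_log4_mul_x (x := n) (by positivity)
  have hlog4 : Real.log 4 = 2 * Real.log 2 := by
    rw [show (4 : ℝ) = 2 ^ 2 by norm_num, Real.log_pow]
    norm_num
  have hN' : (8 : ℝ) * n ≤ N := by exact_mod_cast hN
  have := Real.log_two_gt_d9
  have := Real.log_two_lt_d9
  have hN0 : (0 : ℝ) ≤ N := by positivity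
  rw [hlog4] at hup
  nlinarith

theorem theta_sub_theta {a b : ℕ} (hab : a ≤ b) :
    Chebyshev.theta b - Chebyshev.theta a = ∑ p ∈ primesIoc a b, Real.log p := by
  simp only [Chebyshev.theta, Nat.floor_natCast, primesIoc, Finset.sum_filter]
  rw [sub_eq_iff_eq_add', ← Finset.sum_union]
  · rw [Finset.Ioc_union_Ioc_eq_Ioc (Nat.zero_le a) hab]
  · exact Finset.Ioc_disjoint_Ioc_of_le le_rfl

theorem exists_le_card_primesIoc : ∃ n₀ : ℕ, ∀ n N : ℕ, n₀ ≤ n → 0 < n → 8 * n ≤ N →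
    (N : ℝ) / (4 * Real.log N) ≤ (primesIoc n N).card := by
  obtain ⟨n₀, h⟩ := exists_le_theta_sub_theta
  refine ⟨n₀, fun n N hn hn0 hN => ?_⟩
  have h1 := h n N hn hN
  rw [theta_sub_theta (by omega)] at h1
  have h2 : ∑ p ∈ primesIoc n N, Real.log p ≤ (primesIoc n N).card * Real.log N := by
    rw [← nsmul_eq_mul]
    refine Finset.sum_le_card_nsmul _ _ _ fun p hp => ?_
    rw [mem_primesIoc] at hp
    exact Real.log_le_log (by exact_mod_cast hp.2.pos) (by exact_mod_cast hp.1.2)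
  have hlog : 0 < Real.log N := Real.log_pos (by exact_mod_cast (by omega : 1 < N))
  rw [div_le_iff₀ (by positivity)]
  linarith

theorem exists_le_sum_inv_primesIoc : ∃ a₀ : ℕ, ∃ δ : ℝ, 0 < δ ∧ ∀ a : ℕ, a₀ ≤ a → 0 < a →
    δ ≤ ∑ p ∈ primesIoc (8 ^ a) (8 ^ (2 * a)), (p : ℝ)⁻¹ := by
  obtain ⟨n₀, h⟩ := exists_le_card_primesIoc
  have hl8 : 0 < Real.log 8 := Real.log_pos (by norm_num)
  refine ⟨n₀, 1 / (8 * Real.log 8), by positivity, fun a ha ha0 => ?_⟩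
  have hblock : ∀ i, a ≤ i →
      1 / (4 * ((i + 1) * Real.log 8)) ≤
        ∑ p ∈ primesIoc (8 ^ i) (8 ^ (i + 1)), (p : ℝ)⁻¹ := by
    intro i hi
    have hc := h (8 ^ i) (8 ^ (i + 1))
      ((ha.trans hi).trans (Nat.lt_pow_self (by norm_num)).le) (by positivity)
      (by rw [pow_succ'])
    have hs : (primesIoc (8 ^ i) (8 ^ (i + 1))).card * ((8 : ℝ) ^ (i + 1))⁻¹ ≤
        ∑ p ∈ primesIoc (8 ^ i) (8 ^ (i + 1)), (p : ℝ)⁻¹ := by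
      rw [← nsmul_eq_mul]
      refine Finset.card_nsmul_le_sum _ _ _ fun p hp => ?_
      rw [mem_primesIoc] at hp
      have := hp.2.pos
      gcongr
      exact_mod_cast hp.1.2
    refine le_trans ?_ hs
    rw [← div_eq_mul_inv, le_div_iff₀ (by positivity)]
    refine le_trans (le_of_eq ?_) hc
    push_cast
    rw [Real.log_pow]
    push_cast
    ring
  have htel : ∀ b, a ≤ b → ((b - a : ℕ) : ℝ) * (1 / (4 * (b * Real.log 8))) ≤
      ∑ p ∈ primesIoc (8 ^ a) (8 ^ b), (p : ℝ)⁻¹ := by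
    intro b hb
    induction b, hb using Nat.le_induction with
    | base => simpa using Finset.sum_nonneg fun p _ => by positivity
    | succ b hb ih =>
      have hb0 : (0 : ℝ) < b := by exact_mod_cast ha0.trans_le hb
      have hunion : primesIoc (8 ^ a) (8 ^ (b + 1)) =
          primesIoc (8 ^ a) (8 ^ b) ∪ primesIoc (8 ^ b) (8 ^ (b + 1)) := by
        rw [primesIoc, primesIoc, primesIoc, ← Finset.filter_union,
          Finset.Ioc_union_Ioc_eq_Ioc] <;> gcongr <;> omega
      rw [hunion, Finset.sum_union]
      · have e : ((b + 1 - a : ℕ) : ℝ) = ((b - a : ℕ) : ℝ) + 1 := by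
          rw [Nat.sub_add_comm hb]; push_cast; ring
        rw [e, add_mul, one_mul]
        refine add_le_add (le_trans ?_ ih) ?_
        · gcongr
          simp
        · simpa using hblock b hb
      · exact Finset.disjoint_filter_filter (Finset.Ioc_disjoint_Ioc_of_le le_rfl)
  refine le_trans (le_of_eq ?_) (htel (2 * a) (by omega))
  rw [show 2 * a - a = a by omega]
  have : (0 : ℝ) < a := by exact_mod_cast ha0
  push_cast
  field_simp
  norm_num

open scoped Classical in
/-- The positive side lengths up to `N` without perfect Mondrian partition. -/
noncomputable def noPerfectUpTo (N : ℕ) : Finset ℕ := (Finset.Icc 1 N).filter NoPerfect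

theorem mem_noPerfectUpTo {N m : ℕ} :
    m ∈ noPerfectUpTo N ↔ (1 ≤ m ∧ m ≤ N) ∧ NoPerfect m := by
  simp [noPerfectUpTo]

theorem nCount_eq_card (x : ℕ) : nCount x = (noPerfectUpTo x).card := by
  rw [nCount, ← Set.ncard_coe_finset]
  congr 1
  ext m
  simp [mem_noPerfectUpTo, and_assoc]

/-- The sum of the reciprocals of the side lengths up to `N` without perfect Mondrian partition. -/
noncomputable def noPerfectInvSum (N : ℕ) : ℝ := ∑ m ∈ noPerfectUpTo N, (m : ℝ)⁻¹

theorem prime_mul_inj {Y m m' p p' : ℕ} (hm' : 0 < m') (hm'Y : m' ≤ Y)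
    (hp : p.Prime) (hp' : p'.Prime) (hpY : Y < p) (h : p * m = p' * m') :
    p = p' ∧ m = m' := by
  have hpp : p = p' := by
    rcases (hp.dvd_mul).1 (h ▸ dvd_mul_right p m : p ∣ p' * m') with h1 | h1
    · exact (Nat.prime_dvd_prime_iff_eq hp hp').1 h1
    · have := Nat.le_of_dvd hm' h1
      omega
  subst hpp
  exact ⟨rfl, Nat.eq_of_mul_eq_mul_left hp.pos h⟩

theorem exists_noPerfectInvSum_growth : ∃ a₀ : ℕ, ∃ δ : ℝ, 0 < δ ∧ ∀ a : ℕ, a₀ ≤ a → 0 < a →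
    (1 + δ) * noPerfectInvSum (8 ^ a) ≤ noPerfectInvSum (8 ^ (7 * a)) := by
  obtain ⟨a₀, δ, hδ, h⟩ := exists_le_sum_inv_primesIoc
  refine ⟨a₀, δ, hδ, fun a ha ha0 => ?_⟩
  set S := primesIoc (8 ^ (2 * a + 1)) (8 ^ (2 * (2 * a + 1))) with hS
  have hY : 8 ^ (2 * a + 1) = 8 * (8 ^ a) ^ 2 := by ring
  have hYlt : 8 ^ a < 8 ^ (2 * a + 1) := Nat.pow_lt_pow_right (by norm_num) (by omega)
  have hinj : Set.InjOn (fun q : ℕ × ℕ => q.2 * q.1)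
      (noPerfectUpTo (8 ^ a) ×ˢ S : Finset (ℕ × ℕ)) := by
    rintro ⟨m, p⟩ hq ⟨m', p'⟩ hq' hqq
    simp only [Finset.coe_product, Set.mem_prod, Finset.mem_coe, hS, mem_noPerfectUpTo,
      mem_primesIoc] at hq hq'
    obtain ⟨rfl, rfl⟩ : p = p' ∧ m = m' :=
      prime_mul_inj (Y := 8 ^ a) (by omega) hq'.1.1.2 hq.2.2 hq'.2.2
        (by omega) hqq
    rfl
  have hdisj : Disjoint (noPerfectUpTo (8 ^ a))
      ((noPerfectUpTo (8 ^ a) ×ˢ S).image fun q : ℕ × ℕ => q.2 * q.1) := by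
    rw [Finset.disjoint_left]
    intro n hn hn'
    obtain ⟨⟨m, p⟩, hq, rfl⟩ := Finset.mem_image.1 hn'
    simp only [Finset.mem_product, hS, mem_noPerfectUpTo, mem_primesIoc] at hq hn
    have : p ≤ p * m := Nat.le_mul_of_pos_right p (by omega)
    omega
  have hsub : noPerfectUpTo (8 ^ a) ∪
      (noPerfectUpTo (8 ^ a) ×ˢ S).image (fun q : ℕ × ℕ => q.2 * q.1) ⊆
        noPerfectUpTo (8 ^ (7 * a)) := by
    refine Finset.union_subset ?_ ?_
    · intro m hm
      rw [mem_noPerfectUpTo] at hm ⊢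
      exact ⟨⟨hm.1.1, hm.1.2.trans (Nat.pow_le_pow_right (by norm_num) (by omega))⟩, hm.2⟩
    · intro n hn
      obtain ⟨⟨m, p⟩, hq, rfl⟩ := Finset.mem_image.1 hn
      simp only [Finset.mem_product, hS, mem_noPerfectUpTo, mem_primesIoc] at hq
      obtain ⟨⟨⟨hm1, hmY⟩, hm⟩, ⟨hp1, hp2⟩, hp⟩ := hq
      rw [mem_noPerfectUpTo]
      refine ⟨⟨Nat.mul_pos hp.pos hm1, ?_⟩, hm.prime_mul hm1 hp ?_⟩
      · calc p * m ≤ 8 ^ (2 * (2 * a + 1)) * 8 ^ a := Nat.mul_le_mul hp2 hmY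
          _ = 8 ^ (5 * a + 2) := by rw [← pow_add]; congr 1; ring
          _ ≤ 8 ^ (7 * a) := Nat.pow_le_pow_right (by norm_num) (by omega)
      · have : m ^ 2 ≤ (8 ^ a) ^ 2 := Nat.pow_le_pow_left hmY 2
        change 2 * m ^ 2 < p
        omega
  calc (1 + δ) * noPerfectInvSum (8 ^ a)
      = noPerfectInvSum (8 ^ a) + noPerfectInvSum (8 ^ a) * δ := by ring
    _ ≤ noPerfectInvSum (8 ^ a) + noPerfectInvSum (8 ^ a) * ∑ p ∈ S, (p : ℝ)⁻¹ := by
        gcongr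
        · exact Finset.sum_nonneg fun m _ => by positivity
        · exact h (2 * a + 1) (by omega) (by omega)
    _ = ∑ n ∈ noPerfectUpTo (8 ^ a) ∪
          (noPerfectUpTo (8 ^ a) ×ˢ S).image (fun q : ℕ × ℕ => q.2 * q.1), (n : ℝ)⁻¹ := by
        rw [Finset.sum_union hdisj, Finset.sum_image hinj, Finset.sum_product, noPerfectInvSum,
          Finset.sum_mul_sum]
        congr 1
        refine Finset.sum_congr rfl fun m _ => Finset.sum_congr rfl fun p _ => ?_
        push_cast
        rw [mul_inv, mul_comm]
    _ ≤ noPerfectInvSum (8 ^ (7 * a)) :=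
        Finset.sum_le_sum_of_subset_of_nonneg hsub fun n _ _ => by positivity

theorem exists_pow_le_noPerfectInvSum : ∃ a₀ : ℕ, 0 < a₀ ∧ ∃ δ : ℝ, 0 < δ ∧ ∀ j : ℕ,
    (1 + δ) ^ j ≤ noPerfectInvSum (8 ^ (7 ^ j * a₀)) := by
  obtain ⟨a₀, δ, hδ, h⟩ := exists_noPerfectInvSum_growth
  refine ⟨a₀ + 1, by omega, δ, hδ, fun j => ?_⟩
  induction j with
  | zero =>
    have h1 : 1 ∈ noPerfectUpTo (8 ^ (7 ^ 0 * (a₀ + 1))) :=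
      mem_noPerfectUpTo.2 ⟨⟨le_rfl, Nat.one_le_pow _ _ (by norm_num)⟩, noPerfect_one⟩
    have := Finset.single_le_sum (f := fun m : ℕ => (m : ℝ)⁻¹)
      (fun m _ => by positivity) h1
    simpa [noPerfectInvSum] using this
  | succ j ih =>
    have h1 : 1 ≤ 7 ^ j := Nat.one_le_pow _ _ (by norm_num)
    have := h (7 ^ j * (a₀ + 1)) (by nlinarith) (by positivity)
    rw [pow_succ', pow_succ', mul_assoc]
    refine le_trans ?_ this
    gcongr

theorem exists_le_nCount : ∃ n₀ : ℕ, ∀ Y x : ℕ, n₀ ≤ Y → 0 < Y → 64 * Y ^ 3 ≤ x →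
    (x : ℝ) / (8 * Real.log x) * noPerfectInvSum Y ≤ nCount x := by
  obtain ⟨n₀, h⟩ := exists_le_card_primesIoc
  refine ⟨n₀, fun Y x hY hY0 hx => ?_⟩
  have hYY : Y ≤ Y ^ 2 := Nat.le_self_pow (by norm_num) Y
  have hcard : ((noPerfectUpTo Y).sigma fun m => primesIoc (8 * Y ^ 2) (x / m)).card ≤
      nCount x := by
    rw [nCount_eq_card]
    refine Finset.card_le_card_of_injOn (fun q => q.2 * q.1) ?_ ?_
    · rintro ⟨m, p⟩ hq
      simp only [Finset.coe_sigma, Set.mem_sigma_iff, Finset.mem_coe, mem_noPerfectUpTo,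
        mem_primesIoc] at hq ⊢
      obtain ⟨⟨⟨hm1, hmY⟩, hm⟩, ⟨hp1, hp2⟩, hp⟩ := hq
      have : m ^ 2 ≤ Y ^ 2 := Nat.pow_le_pow_left hmY 2
      exact ⟨⟨Nat.mul_pos hp.pos hm1, (Nat.le_div_iff_mul_le hm1).1 hp2⟩,
        hm.prime_mul hm1 hp (by omega)⟩
    · rintro ⟨m, p⟩ hq ⟨m', p'⟩ hq' hqq
      simp only [Finset.coe_sigma, Set.mem_sigma_iff, Finset.mem_coe, mem_noPerfectUpTo,
        mem_primesIoc] at hq hq'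
      obtain ⟨rfl, rfl⟩ : p = p' ∧ m = m' :=
      prime_mul_inj (Y := Y) (by omega) hq'.1.1.2 hq.2.2 hq'.2.2
        (by omega) hqq
      rfl
  rw [Finset.card_sigma] at hcard
  refine le_trans ?_ (Nat.cast_le.2 hcard)
  push_cast
  rw [noPerfectInvSum, Finset.mul_sum]
  refine Finset.sum_le_sum fun m hm => ?_
  obtain ⟨⟨hm1, hmY⟩, -⟩ := mem_noPerfectUpTo.1 hm
  have hX : 8 * (8 * Y ^ 2) ≤ x / m := by
    rw [Nat.le_div_iff_mul_le hm1]
    calc 8 * (8 * Y ^ 2) * m ≤ 8 * (8 * Y ^ 2) * Y := Nat.mul_le_mul_left _ hmY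
      _ = 64 * Y ^ 3 := by ring
      _ ≤ x := hx
  refine le_trans ?_ (h (8 * Y ^ 2) (x / m) (by omega) (by omega) hX)
  have hX1 : 1 < x / m := by omega
  have hx2 : x ≤ 2 * (x / m) * m := by
    have := Nat.lt_div_mul_add (a := x) hm1
    nlinarith
  have hx2' : (x : ℝ) ≤ 2 * (x / m : ℕ) * m := by exact_mod_cast hx2
  have hm0 : (0 : ℝ) < m := by exact_mod_cast hm1
  have hlog : 0 < Real.log (x / m : ℕ) := Real.log_pos (by exact_mod_cast hX1)
  have hle : Real.log (x / m : ℕ) ≤ Real.log x :=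
    Real.log_le_log (by positivity) (by exact_mod_cast Nat.div_le_self x m)
  calc (x : ℝ) / (8 * Real.log x) * (m : ℝ)⁻¹
      ≤ (2 * (x / m : ℕ) * m) / (8 * Real.log (x / m : ℕ)) * (m : ℝ)⁻¹ := by gcongr
    _ = ((x / m : ℕ) : ℝ) / (4 * Real.log (x / m : ℕ)) := by field_simp; norm_num

theorem tendsto_log_log_natCast :
    Tendsto (fun x : ℕ => Real.log (Real.log x)) atTop atTop :=
  Real.tendsto_log_atTop.comp (Real.tendsto_log_atTop.comp tendsto_natCast_atTop_atTop)

/-- Side lengths without perfect Mondrian partition are more numerous than any constant multiple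
of `x * (log (log x)) ^ 2 / log x`. -/
theorem eventually_le_nCount (C : ℝ) (hC : 0 < C) : ∀ᶠ x : ℕ in atTop,
    C * ((x : ℝ) / Real.log x * Real.log (Real.log x) ^ 2) ≤ nCount x := by
  obtain ⟨n₀, hn₀⟩ := exists_le_nCount
  obtain ⟨a₀, ha₀, δ, hδ, h⟩ := exists_pow_le_noPerfectInvSum
  have hj : Tendsto (fun x : ℕ => ⌊Real.log (Real.log x) / 4⌋₊) atTop atTop :=
    tendsto_nat_floor_atTop.comp (tendsto_log_log_natCast.atTop_div_const (by norm_num))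
  have hpoly : ∀ᶠ j : ℕ in atTop, C * 8 * (8 * (j : ℝ)) ^ 2 ≤ (1 + δ) ^ j := by
    have ht := tendsto_pow_const_div_const_pow_of_one_lt 2 (show 1 < 1 + δ by linarith)
    have hpos : (0 : ℝ) < 1 / (C * 8 * 64) := by positivity
    filter_upwards [ht.eventually_le_const hpos] with j hj
    rw [div_le_div_iff₀ (by positivity) (by positivity)] at hj
    linarith
  have hsmall : ∀ᶠ j : ℕ in atTop,
      (Real.log 64 + 3 * Real.log 8 * a₀) * (7 : ℝ) ^ j ≤ Real.exp (4 * j) := by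
    have h10 : Tendsto (fun j : ℕ => (7 : ℝ) ^ j) atTop atTop :=
      tendsto_pow_atTop_atTop_of_one_lt (by norm_num)
    filter_upwards [h10.eventually_ge_atTop (Real.log 64 + 3 * Real.log 8 * a₀)] with j hj
    have he : (49 : ℝ) ≤ Real.exp 4 := by
      have h27 := Real.exp_one_gt_d9
      have : Real.exp 4 = Real.exp 1 ^ 4 := by rw [← Real.exp_nat_mul]; norm_num
      rw [this]
      calc (49 : ℝ) ≤ 2.7 ^ 4 := by norm_num
        _ ≤ _ := by gcongr; linarith
    calc _ ≤ (7 : ℝ) ^ j * (7 : ℝ) ^ j := by gcongr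
      _ = 49 ^ j := by rw [← mul_pow]; norm_num
      _ ≤ Real.exp 4 ^ j := by gcongr
      _ = Real.exp (4 * j) := by rw [← Real.exp_nat_mul]; ring_nf
  filter_upwards [hj.eventually hpoly, hj.eventually hsmall, hj.eventually_ge_atTop (n₀ + 1),
    tendsto_log_log_natCast.eventually_ge_atTop 1,
    (Real.tendsto_log_atTop.comp tendsto_natCast_atTop_atTop).eventually_ge_atTop 1,
    eventually_ge_atTop 1] with x hp hs hjn hLL hL hx1
  set j := ⌊Real.log (Real.log x) / 4⌋₊ with hjdef
  simp only [Function.comp] at hL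
  have hjle : (4 : ℝ) * j ≤ Real.log (Real.log x) := by
    have := Nat.floor_le (show 0 ≤ Real.log (Real.log x) / 4 by positivity)
    linarith
  have hjge : Real.log (Real.log x) ≤ 8 * j := by
    have h1 := Nat.lt_floor_add_one (Real.log (Real.log x) / 4)
    rw [← hjdef] at h1
    have h2 : (1 : ℝ) ≤ j := by exact_mod_cast (by omega : 1 ≤ j)
    linarith
  have hx0 : (0 : ℝ) < x := by exact_mod_cast hx1
  have hYx : 64 * (8 ^ (7 ^ j * a₀)) ^ 3 ≤ x := by
    have : (64 * (8 ^ (7 ^ j * a₀)) ^ 3 : ℝ) ≤ x := by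
      rw [← Real.log_le_log_iff (by positivity) hx0, Real.log_mul (by norm_num) (by positivity),
        Real.log_pow, Real.log_pow]
      have hexp : Real.exp (4 * j) ≤ Real.log x := by
        rw [← Real.exp_log (show 0 < Real.log x by linarith)]
        exact Real.exp_le_exp.2 hjle
      refine le_trans ?_ (hs.trans hexp)
      have h7 : (1 : ℝ) ≤ 7 ^ j := one_le_pow₀ (by norm_num)
      have h64 : 0 ≤ Real.log 64 := Real.log_nonneg (by norm_num)
      push_cast
      nlinarith
    exact_mod_cast this
  have hYn : n₀ ≤ 8 ^ (7 ^ j * a₀) := by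
    have h1 : j < 7 ^ j := Nat.lt_pow_self (by norm_num)
    have h2 : 7 ^ j * a₀ < 8 ^ (7 ^ j * a₀) := Nat.lt_pow_self (by norm_num)
    nlinarith
  refine le_trans ?_ (hn₀ _ x hYn (by positivity) hYx)
  have hH : C * 8 * Real.log (Real.log x) ^ 2 ≤ noPerfectInvSum (8 ^ (7 ^ j * a₀)) := by
    refine le_trans ?_ (hp.trans (h j))
    gcongr
  calc C * ((x : ℝ) / Real.log x * Real.log (Real.log x) ^ 2)
      = (x : ℝ) / (8 * Real.log x) * (C * 8 * Real.log (Real.log x) ^ 2) := by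
        have : Real.log x ≠ 0 := by linarith
        field_simp
    _ ≤ _ := by gcongr

theorem landau_sum_isEquivalent :
    (fun x : ℕ => ∑ s ∈ Finset.range 3,
      ((x : ℝ) / Real.log x) * (Real.log (Real.log x)) ^ s / (Nat.factorial s)) ~[atTop]
      fun x : ℕ => (x : ℝ) * (Real.log (Real.log x)) ^ 2 / (2 * Real.log x) := by
  refine isEquivalent_of_tendsto_one ?_
  have h1 : Tendsto (fun x : ℕ => (Real.log (Real.log x))⁻¹) atTop (nhds 0) :=
    tendsto_inv_atTop_zero.comp tendsto_log_log_natCast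
  have h2 : Tendsto (fun x : ℕ => 2 * (Real.log (Real.log x))⁻¹ ^ 2 +
      2 * (Real.log (Real.log x))⁻¹ + 1) atTop (nhds 1) := by
    simpa using (((h1.pow 2).const_mul 2).add (h1.const_mul 2)).add_const 1
  refine h2.congr' ?_
  filter_upwards [tendsto_log_log_natCast.eventually_ge_atTop 1,
    (Real.tendsto_log_atTop.comp tendsto_natCast_atTop_atTop).eventually_ge_atTop 1,
    eventually_ge_atTop 1] with x hLL hL hx1
  simp only [Function.comp] at hL
  have hx0 : (0 : ℝ) < x := by exact_mod_cast hx1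
  have hL0 : 0 < Real.log x := by linarith
  have hLL0 : 0 < Real.log (Real.log x) := by linarith
  simp only [Pi.div_apply, Finset.sum_range_succ, Finset.sum_range_zero, Nat.factorial]
  field_simp
  push_cast
  ring

end

/-- `nCount x` is bounded below by a function asymptotic to
`Σ_{s=1}^{3} (x/log x)·(log log x)^{s−1}/(s−1)!`, whose leading term is
`x·(log log x)²/(2 log x)`; in particular `nCount x / x` is asymptotically at
least `(log log x)²/(2 log x)`. -/
theorem nCount_lower_bound :
    (∃ f : ℕ → ℝ,
      (∀ᶠ x in Filter.atTop, f x ≤ (nCount x : ℝ)) ∧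
      Asymptotics.IsEquivalent Filter.atTop f
        (fun x : ℕ => ∑ s ∈ Finset.range 3,
          ((x : ℝ) / Real.log x) * (Real.log (Real.log x)) ^ s / (Nat.factorial s)) ∧
      Asymptotics.IsEquivalent Filter.atTop
        (fun x : ℕ => ∑ s ∈ Finset.range 3,
          ((x : ℝ) / Real.log x) * (Real.log (Real.log x)) ^ s / (Nat.factorial s))
        (fun x : ℕ => (x : ℝ) * (Real.log (Real.log x)) ^ 2 / (2 * Real.log x))) ∧
    ∀ c : ℝ, c < 1 → ∀ᶠ x : ℕ in Filter.atTop,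
      c * (Real.log (Real.log x)) ^ 2 / (2 * Real.log x) ≤ (nCount x : ℝ) / x := by
  have hle := eventually_le_nCount 3 (by norm_num)
  have hlarge : ∀ᶠ x : ℕ in Filter.atTop,
      1 ≤ Real.log (Real.log x) ∧ 1 ≤ Real.log x ∧ 1 ≤ x :=
    (tendsto_log_log_natCast.eventually_ge_atTop 1).and
      (((Real.tendsto_log_atTop.comp tendsto_natCast_atTop_atTop).eventually_ge_atTop 1).and
        (Filter.eventually_ge_atTop 1))
  refine ⟨⟨_, ?_, Asymptotics.IsEquivalent.refl, landau_sum_isEquivalent⟩, fun c hc => ?_⟩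
  · filter_upwards [hle, hlarge] with x hx ⟨hLL, hL, hx1⟩
    refine le_trans ?_ hx
    have hnn : 0 ≤ (x : ℝ) / Real.log x := by positivity
    simp only [Finset.sum_range_succ, Finset.sum_range_zero, Nat.factorial]
    push_cast
    nlinarith [mul_nonneg hnn (sub_nonneg.2 hLL),
      mul_nonneg (mul_nonneg hnn (sub_nonneg.2 hLL)) (zero_le_one.trans hLL),
      mul_nonneg hnn (sq_nonneg (Real.log (Real.log x)))]
  · filter_upwards [hle, hlarge] with x hx ⟨hLL, hL, hx1⟩
    have hx0 : (0 : ℝ) < x := by exact_mod_cast hx1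
    have hL0 : 0 < Real.log x := by linarith
    rw [le_div_iff₀ hx0]
    refine le_trans ?_ hx
    have hnn : 0 ≤ (x : ℝ) / Real.log x * Real.log (Real.log x) ^ 2 := by positivity
    calc c * Real.log (Real.log x) ^ 2 / (2 * Real.log x) * x
        = c / 2 * ((x : ℝ) / Real.log x * Real.log (Real.log x) ^ 2) := by ring
      _ ≤ 3 * ((x : ℝ) / Real.log x * Real.log (Real.log x) ^ 2) := by
        gcongr
        linarith
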